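/- Energy for the mean curvature flow of graphs with quadratic gradient forcing. Let $T>0$ and let $u : [0,T]\times[0,1] \to \mathbb{R}$ be twice continuously differentiable with $u_x(t,x) \neq 0$ for all $(t,x)$, satisfying $u_t = u_{xx}\,(1 + u_x^2)^{-3/2} + u_x^2$ on $[0,T]\times[0,1]$ and $u_t(t,0) = u_t(t,1) = 0$ for all $t$. Then for every $t \in (0,T)$, the energy $E(t) := \int_0^1 \Big( \tfrac{1}{2}\log\frac{\sqrt{1+u_x^2}+1}{\sqrt{1+u_x^2}-1} \; - \; 2\sqrt{1+u_x^2} \; - \; u \Big)\,dx$ is differentiable and $E'(t) = -\int_0^1 \frac{u_t(t,x)^2}{u_x(t,x)^2}\,dx$. (The first term of the integrand is $\mathrm{coth}^{-1}\big(\sqrt{1+u_x^2}\big)$, well defined since $u_x \neq 0$ implies $\sqrt{1+u_x^2} > 1$.) -/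

import Mathlib

open Real Set

/-- Partial derivative of `u(t,x)` with respect to time `t`. -/
noncomputable def pt (u : ℝ → ℝ → ℝ) (t x : ℝ) : ℝ := deriv (fun s => u s x) t

/-- Partial derivative of `u(t,x)` with respect to space `x`. -/
noncomputable def px (u : ℝ → ℝ → ℝ) (t x : ℝ) : ℝ := deriv (fun y => u t y) x

/-- Second partial derivative of `u(t,x)` with respect to space `x`. -/
noncomputable def pxx (u : ℝ → ℝ → ℝ) (t x : ℝ) : ℝ := deriv (fun y => px u t y) x

/-- The energy density as a function of the slope `p`. -/
noncomputable def slopeEnergy (p : ℝ) : ℝ :=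
  (1/2) * Real.log ((Real.sqrt (1 + p ^ 2) + 1) / (Real.sqrt (1 + p ^ 2) - 1))
    - 2 * Real.sqrt (1 + p ^ 2)

/-- The derivative of `slopeEnergy` away from `0`. -/
noncomputable def slopeFlux (p : ℝ) : ℝ := -(1 + 2 * p ^ 2) / (p * Real.sqrt (1 + p ^ 2))

lemma hasDerivAt_sqrt_one_add_sq (p : ℝ) :
    HasDerivAt (fun p : ℝ => Real.sqrt (1 + p ^ 2)) (p / Real.sqrt (1 + p ^ 2)) p := by
  have h := (((hasDerivAt_id p).pow 2).const_add 1).sqrt (by simp only [id, Pi.pow_apply]; positivity)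
  refine h.congr_deriv ?_
  simp only [id, Pi.pow_apply]
  push_cast
  field_simp

lemma one_lt_sqrt_one_add_sq {p : ℝ} (hp : p ≠ 0) : 1 < Real.sqrt (1 + p ^ 2) := by
  rw [Real.lt_sqrt (by norm_num)]
  have : 0 < p ^ 2 := by positivity
  linarith

lemma hasDerivAt_slopeEnergy {p : ℝ} (hp : p ≠ 0) :
    HasDerivAt slopeEnergy (slopeFlux p) p := by
  have hw := hasDerivAt_sqrt_one_add_sq p
  have h1 := one_lt_sqrt_one_add_sq hp
  have hsq : Real.sqrt (1 + p ^ 2) ^ 2 = 1 + p ^ 2 := Real.sq_sqrt (by positivity)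
  have hm : Real.sqrt (1 + p ^ 2) - 1 ≠ 0 := by linarith
  have hq : (Real.sqrt (1 + p ^ 2) + 1) / (Real.sqrt (1 + p ^ 2) - 1) ≠ 0 :=
    div_ne_zero (by linarith) hm
  have h := ((((hw.add_const 1).div (hw.sub_const 1) hm).log hq).const_mul (1/2)).sub
    (hw.const_mul 2)
  refine h.congr_deriv ?_
  unfold slopeFlux
  simp only [Pi.div_apply]
  generalize Real.sqrt (1 + p ^ 2) = w at *
  have hp' : w + 1 ≠ 0 := by linarith
  have hw0 : w ≠ 0 := by linarith
  field_simp
  have : p ^ 2 = w ^ 2 - 1 := by linarith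
  simp only [this]
  ring

lemma hasDerivAt_slopeFlux {p : ℝ} (hp : p ≠ 0) :
    HasDerivAt slopeFlux (1 / (p ^ 2 * Real.sqrt (1 + p ^ 2) ^ 3)) p := by
  have hw := hasDerivAt_sqrt_one_add_sq p
  have h1 := one_lt_sqrt_one_add_sq hp
  have hsq : Real.sqrt (1 + p ^ 2) ^ 2 = 1 + p ^ 2 := Real.sq_sqrt (by positivity)
  have hd : p * Real.sqrt (1 + p ^ 2) ≠ 0 := mul_ne_zero hp (by linarith)
  have h := ((((hasDerivAt_id p).pow 2).const_mul 2).const_add 1).neg.div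
    ((hasDerivAt_id p).mul hw) hd
  refine h.congr_deriv ?_
  simp only [id, Pi.neg_apply, Pi.pow_apply, Pi.mul_apply]
  generalize Real.sqrt (1 + p ^ 2) = w at *
  have hw0 : w ≠ 0 := by linarith
  field_simp
  have : w ^ 2 = p ^ 2 + 1 := by linarith
  simp only [this]
  ring

lemma continuousOn_slopeFlux : ContinuousOn slopeFlux {p | p ≠ 0} := fun _ hp =>
  (hasDerivAt_slopeFlux hp).continuousAt.continuousWithinAt

lemma rpow_neg_three_halves {a : ℝ} (ha : 0 < a) :
    a ^ (-(3/2) : ℝ) = (Real.sqrt a ^ 3)⁻¹ := by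
  rw [Real.rpow_neg ha.le, Real.sqrt_eq_rpow, ← Real.rpow_natCast, ← Real.rpow_mul ha.le]
  norm_num

section Partials

variable {E : Type*} [NormedAddCommGroup E] [NormedSpace ℝ E]

lemma hasDerivAt_slice_fst {g : ℝ × ℝ → E} {t x : ℝ}
    (hg : DifferentiableAt ℝ g (t, x)) :
    HasDerivAt (fun s => g (s, x)) (fderiv ℝ g (t, x) (1, 0)) t :=
  hg.hasFDerivAt.comp_hasDerivAt t ((hasDerivAt_id t).prodMk (hasDerivAt_const t x))

lemma hasDerivAt_slice_snd {g : ℝ × ℝ → E} {t x : ℝ}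
    (hg : DifferentiableAt ℝ g (t, x)) :
    HasDerivAt (fun y => g (t, y)) (fderiv ℝ g (t, x) (0, 1)) x :=
  hg.hasFDerivAt.comp_hasDerivAt x ((hasDerivAt_const x t).prodMk (hasDerivAt_id x))

end Partials

section C2

variable {u : ℝ → ℝ → ℝ} (hu : ContDiff ℝ 2 (fun q : ℝ × ℝ => u q.1 q.2))
include hu

lemma hasDerivAt_pt (t x : ℝ) : HasDerivAt (fun s => u s x) (pt u t x) t :=
  (hasDerivAt_slice_fst (hu.differentiable (by norm_num) (t, x))).differentiableAt.hasDerivAt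

lemma pt_eq_fderiv (t x : ℝ) :
    pt u t x = fderiv ℝ (fun q : ℝ × ℝ => u q.1 q.2) (t, x) (1, 0) :=
  (hasDerivAt_slice_fst (hu.differentiable (by norm_num) (t, x))).deriv

lemma px_eq_fderiv (t x : ℝ) :
    px u t x = fderiv ℝ (fun q : ℝ × ℝ => u q.1 q.2) (t, x) (0, 1) :=
  (hasDerivAt_slice_snd (hu.differentiable (by norm_num) (t, x))).deriv

lemma contDiff_fderiv_one : ContDiff ℝ 1 (fderiv ℝ (fun q : ℝ × ℝ => u q.1 q.2)) :=
  hu.fderiv_right (by norm_num)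

lemma contDiff_px : ContDiff ℝ 1 (fun q : ℝ × ℝ => px u q.1 q.2) := by
  simp only [px_eq_fderiv hu]
  exact (contDiff_fderiv_one hu).clm_apply contDiff_const

lemma contDiff_pt : ContDiff ℝ 1 (fun q : ℝ × ℝ => pt u q.1 q.2) := by
  simp only [pt_eq_fderiv hu]
  exact (contDiff_fderiv_one hu).clm_apply contDiff_const

lemma hasDerivAt_px_snd (t x : ℝ) : HasDerivAt (fun y => px u t y) (pxx u t x) x :=
  (hasDerivAt_slice_snd
    ((contDiff_px hu).differentiable (by norm_num) (t, x))).differentiableAt.hasDerivAt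

lemma hasDerivAt_px_fst (t x : ℝ) : HasDerivAt (fun s => px u s x) (px (pt u) t x) t := by
  have hd : DifferentiableAt ℝ (fderiv ℝ (fun q : ℝ × ℝ => u q.1 q.2)) (t, x) :=
    (contDiff_fderiv_one hu).differentiable (by norm_num) (t, x)
  have h1 := (hasDerivAt_slice_fst hd).clm_apply (hasDerivAt_const t ((0 : ℝ), (1 : ℝ)))
  have h2 := (hasDerivAt_slice_snd hd).clm_apply (hasDerivAt_const x ((1 : ℝ), (0 : ℝ)))
  have hs : IsSymmSndFDerivAt ℝ (fun q : ℝ × ℝ => u q.1 q.2) (t, x) :=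
    hu.contDiffAt.isSymmSndFDerivAt (by simp)
  simp only [map_zero, add_zero, ← px_eq_fderiv hu, ← pt_eq_fderiv hu] at h1 h2
  refine h1.congr_deriv ?_
  rw [hs.eq, ← h2.deriv]
  rfl

lemma hasDerivAt_pt_snd (t x : ℝ) : HasDerivAt (fun y => pt u t y) (px (pt u) t x) x :=
  (hasDerivAt_slice_snd
    ((contDiff_pt hu).differentiable (by norm_num) (t, x))).differentiableAt.hasDerivAt

lemma continuous_px_pt : Continuous (fun q : ℝ × ℝ => px (pt u) q.1 q.2) := by
  have h : ∀ q : ℝ × ℝ, px (pt u) q.1 q.2 =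
      fderiv ℝ (fun q : ℝ × ℝ => pt u q.1 q.2) q (0, 1) := fun q =>
    (hasDerivAt_slice_snd ((contDiff_pt hu).differentiable (by norm_num) q)).deriv
  simp only [h]
  exact ((contDiff_pt hu).continuous_fderiv (by norm_num)).clm_apply continuous_const

end C2

/-- Differentiation under the integral sign over a compact rectangle. -/
lemma hasDerivAt_integral_of_continuousOn {a b c d : ℝ} (hcd : c ≤ d) {F F' : ℝ → ℝ → ℝ}
    (hF : ContinuousOn (fun q : ℝ × ℝ => F q.1 q.2) (Icc a b ×ˢ Icc c d))
    (hF' : ContinuousOn (fun q : ℝ × ℝ => F' q.1 q.2) (Icc a b ×ˢ Icc c d))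
    (hderiv : ∀ t ∈ Icc a b, ∀ x ∈ Icc c d, HasDerivAt (fun s => F s x) (F' t x) t)
    {t : ℝ} (ht : t ∈ Ioo a b) :
    HasDerivAt (fun s => ∫ x in c..d, F s x) (∫ x in c..d, F' t x) t := by
  obtain ⟨C, hC⟩ := (isCompact_Icc.prod isCompact_Icc).exists_bound_of_continuousOn hF'
  have hslice {G : ℝ → ℝ → ℝ}
      (hG : ContinuousOn (fun q : ℝ × ℝ => G q.1 q.2) (Icc a b ×ˢ Icc c d))
      {s : ℝ} (hs : s ∈ Icc a b) : IntervalIntegrable (G s) MeasureTheory.volume c d := by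
    refine ContinuousOn.intervalIntegrable ?_
    rw [uIcc_of_le hcd]
    exact hG.comp (f := fun x => (s, x)) (by fun_prop) fun x hx => ⟨hs, hx⟩
  have hsub : Ioo a b ⊆ Icc a b := Ioo_subset_Icc_self
  have hmem {x : ℝ} (hx : x ∈ uIoc c d) : x ∈ Icc c d := by
    rw [uIoc_of_le hcd] at hx
    exact Ioc_subset_Icc_self hx
  refine (intervalIntegral.hasDerivAt_integral_of_dominated_loc_of_deriv_le
    (bound := fun _ => C) (isOpen_Ioo.mem_nhds ht) ?_ (hslice hF (hsub ht))
    (intervalIntegrable_iff.1 (hslice hF' (hsub ht))).aestronglyMeasurable ?_ intervalIntegrable_const ?_).2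
  · filter_upwards [isOpen_Ioo.mem_nhds ht] with s hs
    exact (intervalIntegrable_iff.1 (hslice hF (hsub hs))).aestronglyMeasurable
  · exact Filter.Eventually.of_forall fun x hx s hs => hC (s, x) ⟨hsub hs, hmem hx⟩
  · exact Filter.Eventually.of_forall fun x hx s hs => hderiv s (hsub hs) x (hmem hx)

/-- Energy for the mean curvature flow of graphs with quadratic gradient forcing. -/
theorem energy_mcf_quadratic_forcing
    (T : ℝ) (hT : 0 < T)
    (u : ℝ → ℝ → ℝ)
    (hu : ContDiff ℝ 2 (fun q : ℝ × ℝ => u q.1 q.2))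
    (hne : ∀ t ∈ Icc (0:ℝ) T, ∀ x ∈ Icc (0:ℝ) 1, px u t x ≠ 0)
    (hPDE : ∀ t ∈ Icc (0:ℝ) T, ∀ x ∈ Icc (0:ℝ) 1,
      pt u t x = pxx u t x * (1 + (px u t x) ^ 2) ^ (-(3/2) : ℝ) + (px u t x) ^ 2)
    (hBC : ∀ t ∈ Icc (0:ℝ) T, pt u t 0 = 0 ∧ pt u t 1 = 0) :
    ∀ t ∈ Ioo (0:ℝ) T,
      HasDerivAt
        (fun s => ∫ x in (0:ℝ)..1,
          ((1/2) * Real.log ((Real.sqrt (1 + (px u s x) ^ 2) + 1) /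
              (Real.sqrt (1 + (px u s x) ^ 2) - 1))
            - 2 * Real.sqrt (1 + (px u s x) ^ 2) - u s x))
        (-∫ x in (0:ℝ)..1, (pt u t x) ^ 2 / (px u t x) ^ 2) t := by
  intro t ht
  have ht' : t ∈ Icc 0 T := Ioo_subset_Icc_self ht
  have hcpx : Continuous (fun q : ℝ × ℝ => px u q.1 q.2) := (contDiff_px hu).continuous
  have hcpt : Continuous (fun q : ℝ × ℝ => pt u q.1 q.2) := (contDiff_pt hu).continuous
  have hE : ContinuousOn slopeEnergy {p | p ≠ 0} := fun _ hp =>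
    (hasDerivAt_slopeEnergy hp).continuousAt.continuousWithinAt
  have hmaps : MapsTo (fun q : ℝ × ℝ => px u q.1 q.2) (Icc 0 T ×ˢ Icc 0 1) {p | p ≠ 0} :=
    fun q hq => hne q.1 hq.1 q.2 hq.2
  have hF' : ContinuousOn (fun q : ℝ × ℝ =>
      slopeFlux (px u q.1 q.2) * px (pt u) q.1 q.2 - pt u q.1 q.2) (Icc 0 T ×ˢ Icc 0 1) :=
    ((continuousOn_slopeFlux.comp hcpx.continuousOn hmaps).mul
      (continuous_px_pt hu).continuousOn).sub hcpt.continuousOn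
  have key := hasDerivAt_integral_of_continuousOn zero_le_one
    (F := fun s x => slopeEnergy (px u s x) - u s x)
    (F' := fun s x => slopeFlux (px u s x) * px (pt u) s x - pt u s x)
    ((hE.comp hcpx.continuousOn hmaps).sub hu.continuous.continuousOn) hF'
    (fun s hs x hx => HasDerivAt.fun_sub
      (HasDerivAt.comp (h₂ := slopeEnergy) s (hasDerivAt_slopeEnergy (hne s hs x hx))
        (hasDerivAt_px_fst hu s x))
      (hasDerivAt_pt hu s x)) ht
  refine key.congr_deriv ?_
  have hslice : ContinuousOn
      (fun x => slopeFlux (px u t x) * px (pt u) t x - pt u t x) (Icc 0 1) :=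
    hF'.comp (f := fun x => (t, x)) (by fun_prop) fun x hx => ⟨ht', hx⟩
  have hquot : ContinuousOn (fun x => pt u t x ^ 2 / px u t x ^ 2) (Icc 0 1) :=
    ((hcpt.comp (Continuous.prodMk_right t)).pow 2).continuousOn.div
      ((hcpx.comp (Continuous.prodMk_right t)).pow 2).continuousOn
      fun x hx => pow_ne_zero 2 (hne t ht' x hx)
  have hu01 : uIcc (0 : ℝ) 1 = Icc 0 1 := uIcc_of_le zero_le_one
  have hI := (hu01 ▸ hslice).intervalIntegrable (μ := MeasureTheory.volume)
  have hJ := (hu01 ▸ hquot).intervalIntegrable (μ := MeasureTheory.volume)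
  -- The sum of the two integrands is the `x`-derivative of the flux `slopeFlux u_x * u_t`.
  have hFTC := intervalIntegral.integral_eq_sub_of_hasDerivAt
    (f := fun x => slopeFlux (px u t x) * pt u t x) (fun x hx => ?_) (hI.add hJ)
  · rw [intervalIntegral.integral_add hI hJ] at hFTC
    simp only [(hBC t ht').1, (hBC t ht').2, mul_zero, sub_zero] at hFTC
    linarith
  · rw [hu01] at hx
    have hp := hne t ht' x hx
    refine (((hasDerivAt_slopeFlux hp).comp x (hasDerivAt_px_snd hu t x)).mul
      (hasDerivAt_pt_snd hu t x)).congr_deriv ?_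
    have hpde := hPDE t ht' x hx
    rw [rpow_neg_three_halves (by positivity)] at hpde
    have hw : Real.sqrt (1 + px u t x ^ 2) ≠ 0 := by positivity
    simp only [Function.comp_apply]
    have hflux : 1 / (px u t x ^ 2 * Real.sqrt (1 + px u t x ^ 2) ^ 3) * pxx u t x
        = pt u t x / px u t x ^ 2 - 1 := by
      rw [hpde]
      field_simp
      ring
    rw [hflux]
    ring
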